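/- Let X be a uniform random point on √n·S^(n−1) (the sphere of radius √n in ℝⁿ) with n ≥ 5, and let 1 ≤ k ≤ n−4. Let Z be a standard Gaussian vector in ℝ^k. Then the total variation distance between the law of (X₁,…,X_k) and the law of Z is at most 2(k+3)/(n−k−3). -/

import Mathlib

open MeasureTheory ProbabilityTheory

/-- Total variation distance `d_TV(μ,ν) = 2·sup_A |μ(A) − ν(A)|` over measurable sets. -/
noncomputable def dTV {α : Type*} [MeasurableSpace α] (μ ν : Measure α) : ℝ :=
  2 * ⨆ A : {s : Set α // MeasurableSet s}, |(μ A).toReal - (ν A).toReal|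

lemma charFun_eq_of_norm_eq {E : Type*} [NormedAddCommGroup E] [InnerProductSpace ℝ E]
    [CompleteSpace E] [MeasurableSpace E] [BorelSpace E] {μ : Measure E}
    (hμ : ∀ T : E ≃ₗᵢ[ℝ] E, μ.map T = μ) {s t : E} (hst : ‖s‖ = ‖t‖) :
    charFun μ s = charFun μ t := by
  set T : E ≃ₗᵢ[ℝ] E := (ℝ ∙ (s - t))ᗮ.reflection with hT
  have hTs : T s = t := Submodule.reflection_sub hst
  rw [← hTs, ← hμ T, charFun_apply, charFun_apply, hμ T]
  conv_rhs => rw [← hμ T]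
  rw [integral_map T.continuous.aemeasurable (by fun_prop)]
  simp [LinearIsometryEquiv.inner_map_map]

lemma eq_of_rotation_invariant_of_sphere {E : Type*} [NormedAddCommGroup E]
    [InnerProductSpace ℝ E] [CompleteSpace E] [SecondCountableTopology E] [MeasurableSpace E]
    [BorelSpace E]
    {μ ν : Measure E} [IsProbabilityMeasure μ] [IsProbabilityMeasure ν]
    (hμ : ∀ T : E ≃ₗᵢ[ℝ] E, μ.map T = μ) (hν : ∀ T : E ≃ₗᵢ[ℝ] E, ν.map T = ν)
    {r : ℝ} (hr : 0 < r) (hμr : ∀ᵐ x ∂μ, ‖x‖ = r) (hνr : ∀ᵐ x ∂ν, ‖x‖ = r) : μ = ν := by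
  refine Measure.ext_of_charFun (funext fun t ↦ ?_)
  set a : ℝ := ‖t‖ / r
  have key (m m' : Measure E) [IsProbabilityMeasure m'] (hm : ∀ T : E ≃ₗᵢ[ℝ] E, m.map T = m)
      (hr' : ∀ᵐ x ∂m', ‖x‖ = r) : charFun m t = ∫ y, charFun m (a • y) ∂m' := by
    have h : ∀ᵐ y ∂m', charFun m (a • y) = charFun m t := by
      filter_upwards [hr'] with y hy
      refine charFun_eq_of_norm_eq hm ?_
      rw [norm_smul, hy, Real.norm_of_nonneg (by positivity), div_mul_cancel₀ _ hr.ne']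
    rw [integral_congr_ae h]
    simp
  rw [key μ ν hμ hνr, key ν μ hν hμr]
  simp_rw [charFun_apply]
  rw [integral_integral_swap]
  · refine integral_congr_ae (.of_forall fun x ↦ integral_congr_ae (.of_forall fun y ↦ ?_))
    simp [inner_smul_right, real_inner_comm]
  · refine Integrable.of_bound (C := 1) (Continuous.aestronglyMeasurable (by fun_prop))
      (.of_forall fun p ↦ ?_)
    simp only [Function.uncurry]
    rw [Complex.norm_exp_ofReal_mul_I]

lemma pi_gaussianReal_eq_withDensity (k : ℕ) :
    Measure.pi (fun _ : Fin k => gaussianReal 0 1) =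
      volume.withDensity fun x ↦ ENNReal.ofReal (∏ i, gaussianPDFReal 0 1 (x i)) := by
  refine Measure.pi_eq fun s hs ↦ ?_
  rw [withDensity_apply _ (MeasurableSet.univ_pi hs)]
  have hres : (volume : Measure (Fin k → ℝ)).restrict (Set.univ.pi s) =
      Measure.pi fun i ↦ (volume : Measure ℝ).restrict (s i) := by
    rw [volume_pi, Measure.restrict_pi_pi]
  rw [hres, ← ofReal_integral_eq_lintegral_ofReal, integral_fintype_prod_eq_prod,
    ENNReal.ofReal_prod_of_nonneg]
  · simp_rw [gaussianReal_apply_eq_integral 0 one_ne_zero]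
  · exact fun i _ ↦ integral_nonneg fun x ↦ gaussianPDFReal_nonneg _ _ _
  · exact Integrable.fintype_prod fun i ↦ (integrable_gaussianPDFReal 0 1).restrict
  · exact .of_forall fun x ↦ Finset.prod_nonneg fun i _ ↦ gaussianPDFReal_nonneg _ _ _

lemma prod_gaussianPDFReal_eq {k : ℕ} (x : Fin k → ℝ) :
    ∏ i, gaussianPDFReal 0 1 (x i) = (√(2 * Real.pi))⁻¹ ^ k * Real.exp (-(∑ i, x i ^ 2) / 2) := by
  simp [gaussianPDFReal, Finset.prod_mul_distrib, ← Real.exp_sum, ← Finset.sum_div]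

lemma antitoneOn_log_Gamma_add_sub :
    AntitoneOn (fun x : ℝ ↦ Real.log (Real.Gamma x) + x - x * Real.log x) (Set.Ioi 0) := by
  have hd (x : ℝ) (hx : 0 < x) :
      DifferentiableAt ℝ (fun x ↦ Real.log (Real.Gamma x)) x :=
    (Real.differentiableAt_Gamma fun m ↦ by
      have : (0:ℝ) ≤ m := m.cast_nonneg
      linarith).log (Real.Gamma_pos_of_pos hx).ne'
  have hd' (x : ℝ) (hx : 0 < x) := ((hd x hx).hasDerivAt.add (hasDerivAt_id x)).sub
    ((hasDerivAt_id x).mul (Real.hasDerivAt_log hx.ne'))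
  refine antitoneOn_of_deriv_nonpos (convex_Ioi 0)
    (fun x hx ↦ (hd' x hx).continuousAt.continuousWithinAt)
    (fun x hx ↦ (hd' x (by simpa using hx)).differentiableAt.differentiableWithinAt) fun x hx ↦ ?_
  replace hx : 0 < x := by simpa using hx
  have h1 : deriv (fun x ↦ Real.log (Real.Gamma x)) x ≤ Real.log x := by
    have := Real.convexOn_log_Gamma.deriv_le_slope (x := x) (y := x + 1) hx
      (by simp; positivity) (by simp) (hd x hx)
    refine this.trans_eq ?_
    rw [slope_def_field]
    simp only [Function.comp, Real.Gamma_add_one hx.ne',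
      Real.log_mul hx.ne' (Real.Gamma_pos_of_pos hx).ne']
    ring
  have h2 := (hd' x hx).deriv
  refine (Eq.trans rfl h2).trans_le ?_
  simp [hx.ne', h1]

lemma max_zero_rpow_le_exp {m b : ℝ} (hm : 0 < m) :
    (max 0 b) ^ m ≤ (2 * m) ^ m * Real.exp (b / 2 - m) := by
  rcases le_or_gt b 0 with hb | hb
  · rw [max_eq_left hb, Real.zero_rpow hm.ne']
    positivity
  rw [max_eq_right hb.le]
  have h1 : b / (2 * m) ≤ Real.exp (b / (2 * m) - 1) := by
    linarith [Real.add_one_le_exp (b / (2 * m) - 1)]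
  have h2 := Real.rpow_le_rpow (by positivity) h1 hm.le
  rw [Real.div_rpow hb.le (by positivity), ← Real.exp_mul, div_le_iff₀' (by positivity)] at h2
  rwa [sub_mul, one_mul, div_mul_eq_mul_div, mul_div_mul_right _ _ hm.ne'] at h2

lemma rpow_sub_rpow_le {a b p : ℝ} (hp : 1 ≤ p) (hb : 0 ≤ b) (hab : b ≤ a) :
    a ^ p - b ^ p ≤ p * a ^ (p - 1) * (a - b) := by
  rcases hb.trans hab |>.eq_or_lt with h | h
  · obtain rfl : b = a := by linarith
    simp
  have h1 := one_add_mul_self_le_rpow_one_add (s := b / a - 1)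
    (by have : 0 ≤ b / a := by positivity
        linarith) hp
  rw [add_sub_cancel, Real.div_rpow hb h.le, le_div_iff₀ (by positivity)] at h1
  have h2 : a ^ p = a ^ (p - 1) * a := by
    rw [← Real.rpow_add_one h.ne']; ring_nf
  have h3 : (1 + p * (b / a - 1)) * a ^ p = a ^ p - p * a ^ (p - 1) * (a - b) := by
    rw [h2]; field_simp; ring
  linarith

lemma volume_ball_sqrt {l : ℕ} (hl : 0 < l) {a : ℝ} (ha : 0 ≤ a) :
    volume (Metric.ball (0 : EuclideanSpace ℝ (Fin l)) √a) =
      ENNReal.ofReal (√Real.pi ^ l / Real.Gamma (l / 2 + 1) * a ^ ((l : ℝ) / 2)) := by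
  have : Nonempty (Fin l) := ⟨⟨0, hl⟩⟩
  rw [EuclideanSpace.volume_ball, Fintype.card_fin, ← ENNReal.ofReal_pow (by positivity),
    ← ENNReal.ofReal_mul (by positivity), mul_comm, Real.sqrt_eq_rpow a, ← Real.rpow_mul_natCast ha]
  ring_nf

lemma volume_ball_sqrt_diff {l : ℕ} (hl : 0 < l) {a b : ℝ} (hb : 0 ≤ b) (hab : b ≤ a) :
    volume (Metric.ball (0 : EuclideanSpace ℝ (Fin l)) √a \ Metric.ball 0 √b) =
      ENNReal.ofReal (√Real.pi ^ l / Real.Gamma (l / 2 + 1) *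
        (a ^ ((l : ℝ) / 2) - b ^ ((l : ℝ) / 2))) := by
  have hG : 0 < Real.Gamma ((l : ℝ) / 2 + 1) := Real.Gamma_pos_of_pos (by positivity)
  rw [measure_sdiff (Metric.ball_subset_ball (Real.sqrt_le_sqrt hab))
    measurableSet_ball.nullMeasurableSet measure_ball_lt_top.ne, volume_ball_sqrt hl hb,
    volume_ball_sqrt hl (hb.trans hab), ← ENNReal.ofReal_sub _ (by positivity), mul_sub]

/-- The part of Euclidean space where the squared norm lies in `[N, N * (1 + u))`. -/
def sphericalShell (n : ℕ) (N u : ℝ) : Set (EuclideanSpace ℝ (Fin n)) :=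
  {y | N ≤ ‖y‖ ^ 2 ∧ ‖y‖ ^ 2 < N * (1 + u)}

lemma measurableSet_sphericalShell (n : ℕ) (N u : ℝ) : MeasurableSet (sphericalShell n N u) :=
  (measurableSet_le measurable_const (measurable_norm.pow_const 2)).inter
    (measurableSet_lt (measurable_norm.pow_const 2) measurable_const)

lemma sphericalShell_eq (n : ℕ) (N u : ℝ) :
    sphericalShell n N u = Metric.ball 0 √(N * (1 + u)) \ Metric.ball 0 √N := by
  ext y
  simp [sphericalShell, Real.lt_sqrt (norm_nonneg y), and_comm]

lemma volume_sphericalShell_lt_top (n : ℕ) (N u : ℝ) :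
    volume (sphericalShell n N u) < ⊤ := by
  rw [sphericalShell_eq]
  exact (measure_mono Set.sdiff_subset).trans_lt measure_ball_lt_top

lemma le_volume_sphericalShell {n : ℕ} (hn : 2 ≤ n) {N u : ℝ} (hN : 0 < N) (hu : 0 < u) :
    ENNReal.ofReal (√Real.pi ^ n / Real.Gamma (n / 2 + 1) * N ^ ((n : ℝ) / 2) * (n / 2) * u) ≤
      volume (sphericalShell n N u) := by
  have hG : 0 < Real.Gamma ((n : ℝ) / 2 + 1) := Real.Gamma_pos_of_pos (by positivity)
  have hn' : (2 : ℝ) ≤ n := by exact_mod_cast hn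
  rw [sphericalShell_eq, volume_ball_sqrt_diff (by omega) hN.le (by nlinarith)]
  refine ENNReal.ofReal_le_ofReal ?_
  rw [mul_assoc, mul_assoc]
  refine mul_le_mul_of_nonneg_left ?_ (by positivity)
  rw [Real.mul_rpow hN.le (by positivity)]
  have := one_add_mul_self_le_rpow_one_add (s := u) (by linarith) (p := n / 2) (by linarith)
  have h2 := mul_le_mul_of_nonneg_left this (by positivity : 0 ≤ N ^ ((n : ℝ) / 2))
  linarith

lemma volume_shell_slice_le {l : ℕ} (hl : 3 ≤ l) {N u q : ℝ} (hN : 0 < N) (hu : 0 < u) :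
    volume {z : EuclideanSpace ℝ (Fin l) | N ≤ q + ‖z‖ ^ 2 ∧ q + ‖z‖ ^ 2 < N * (1 + u)} ≤
      ENNReal.ofReal (√Real.pi ^ l / Real.Gamma (l / 2 + 1) * ((l / 2) *
        ((l - 2) ^ ((l : ℝ) / 2 - 1) * Real.exp ((N * (1 + u) - q) / 2 - (l / 2 - 1))) *
          (N * u))) := by
  have hG : 0 < Real.Gamma ((l : ℝ) / 2 + 1) := Real.Gamma_pos_of_pos (by positivity)
  have hl' : (3 : ℝ) ≤ l := by exact_mod_cast hl
  have hNu : 0 < N * u := by positivity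
  set a := max 0 (N * (1 + u) - q)
  set b := max 0 (N - q)
  have hb : 0 ≤ b := le_max_left _ _
  have hab : b ≤ a := max_le_max le_rfl (by linarith)
  have hab' : a - b ≤ N * u := by
    have := le_max_left 0 (N - q)
    have := le_max_right 0 (N - q)
    rw [sub_le_iff_le_add]
    exact max_le (by linarith) (by linarith)
  calc _ ≤ volume (Metric.ball (0 : EuclideanSpace ℝ (Fin l)) √a \ Metric.ball 0 √b) := by
        refine measure_mono fun z hz ↦ ?_
        obtain ⟨h1, h2⟩ := hz
        simp only [Set.mem_sdiff, mem_ball_zero_iff, not_lt, Real.lt_sqrt (norm_nonneg z)]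
        exact ⟨lt_max_of_lt_right (by linarith), max_le (by positivity) (by linarith)⟩
    _ ≤ _ := by
        rw [volume_ball_sqrt_diff (by omega) hb hab]
        refine ENNReal.ofReal_le_ofReal (mul_le_mul_of_nonneg_left ?_ (by positivity))
        refine (rpow_sub_rpow_le (by linarith) hb hab).trans ?_
        have h3 := max_zero_rpow_le_exp (m := (l : ℝ) / 2 - 1) (b := N * (1 + u) - q) (by linarith)
        rw [show 2 * ((l : ℝ) / 2 - 1) = l - 2 by ring] at h3
        have h4 : (0 : ℝ) ≤ (l - 2) ^ ((l : ℝ) / 2 - 1) := Real.rpow_nonneg (by linarith) _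
        have h5 := sub_nonneg.2 hab
        gcongr

lemma measurePreserving_append (k l : ℕ) :
    MeasurePreserving (fun p : (Fin k → ℝ) × EuclideanSpace ℝ (Fin l) ↦
      WithLp.toLp 2 (Fin.append p.1 p.2)) := by
  have h1 : MeasurePreserving (Prod.map id WithLp.ofLp :
      (Fin k → ℝ) × EuclideanSpace ℝ (Fin l) → (Fin k → ℝ) × (Fin l → ℝ)) :=
    (MeasurePreserving.id _).prod (PiLp.volume_preserving_ofLp _)
  have h2 := volume_measurePreserving_sumPiEquivProdPi_symm (fun _ : Fin k ⊕ Fin l ↦ ℝ)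
  have h3 := volume_measurePreserving_piCongrLeft (fun _ : Fin (k + l) ↦ ℝ) finSumFinEquiv
  convert (PiLp.volume_preserving_toLp (Fin (k + l))).comp (h3.comp (h2.comp h1)) using 1
  ext p i
  simp only [Function.comp]
  refine Fin.addCases (fun i ↦ ?_) (fun i ↦ ?_) i
  · rw [← finSumFinEquiv_apply_left]
    simp [MeasurableEquiv.piCongrLeft, Equiv.piCongrLeft_apply_apply, -finSumFinEquiv_apply_left]
    simp
    rfl
  · rw [← finSumFinEquiv_apply_right]
    simp [MeasurableEquiv.piCongrLeft, Equiv.piCongrLeft_apply_apply, -finSumFinEquiv_apply_right]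
    simp
    rfl

lemma norm_toLp_append_sq {k l : ℕ} (x : Fin k → ℝ) (z : EuclideanSpace ℝ (Fin l)) :
    ‖WithLp.toLp 2 (Fin.append x z)‖ ^ 2 = ∑ i, x i ^ 2 + ‖z‖ ^ 2 := by
  simp [EuclideanSpace.norm_sq_eq, Fin.sum_univ_add]

lemma volume_sphericalShell_inter_le {k l : ℕ} (hl : 3 ≤ l) {N u : ℝ} (hN : 0 < N) (hu : 0 < u)
    {B : Set (Fin k → ℝ)} (hB : MeasurableSet B) :
    volume (sphericalShell (k + l) N u ∩ (fun x i ↦ x (Fin.castAdd l i)) ⁻¹' B) ≤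
      ENNReal.ofReal (√Real.pi ^ l / Real.Gamma (l / 2 + 1) * (l / 2) *
        (l - 2) ^ ((l : ℝ) / 2 - 1) * Real.exp (N * (1 + u) / 2 - (l / 2 - 1)) * N *
          √(2 * Real.pi) ^ k * u) * Measure.pi (fun _ : Fin k => gaussianReal 0 1) B := by
  have hG : 0 < Real.Gamma ((l : ℝ) / 2 + 1) := Real.Gamma_pos_of_pos (by positivity)
  have hl' : (3 : ℝ) ≤ l := by exact_mod_cast hl
  have hl2 : (0 : ℝ) < l - 2 := by linarith
  have hmeas : MeasurableSet
      (sphericalShell (k + l) N u ∩ (fun x i ↦ x (Fin.castAdd l i)) ⁻¹' B) :=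
    (measurableSet_sphericalShell _ _ _).inter (hB.preimage (by fun_prop))
  rw [← (measurePreserving_append k l).measure_preimage hmeas.nullMeasurableSet,
    Measure.volume_eq_prod,
    Measure.prod_apply (hmeas.preimage (measurePreserving_append k l).measurable),
    pi_gaussianReal_eq_withDensity, withDensity_apply _ hB, ← lintegral_const_mul' _ _ (by simp),
    ← lintegral_indicator hB]
  refine lintegral_mono fun x ↦ ?_
  by_cases hx : x ∈ B
  · rw [Set.indicator_of_mem hx, ← ENNReal.ofReal_mul (by positivity)]
    refine (measure_mono fun z hz ↦ ?_).trans
      ((volume_shell_slice_le hl (q := ∑ i, x i ^ 2) hN hu).trans_eq ?_)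
    · simpa [sphericalShell, norm_toLp_append_sq] using hz.1
    · congr 1
      rw [prod_gaussianPDFReal_eq, show (N * (1 + u) - ∑ i, x i ^ 2) / 2 - ((l : ℝ) / 2 - 1) =
        (N * (1 + u) / 2 - (l / 2 - 1)) + -(∑ i, x i ^ 2) / 2 by ring, Real.exp_add]
      have : √(2 * Real.pi) ^ k * (√(2 * Real.pi))⁻¹ ^ k = 1 := by
        rw [← mul_pow, mul_inv_cancel₀ (by positivity), one_pow]
      linear_combination (-(√Real.pi ^ l / Real.Gamma (l / 2 + 1) * (l / 2) *
        (l - 2) ^ ((l : ℝ) / 2 - 1) * Real.exp (N * (1 + u) / 2 - (l / 2 - 1)) * N * u *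
          Real.exp (-(∑ i, x i ^ 2) / 2))) * this
  · rw [Set.indicator_of_notMem hx]
    refine (measure_mono_null (fun z hz ↦ hx ?_) measure_empty).le
    simpa using hz.2

lemma Gamma_mul_rpow_le {x y : ℝ} (hx : 0 < x) (hxy : x ≤ y) :
    Real.Gamma y * x ^ x * Real.exp (y - x) ≤ Real.Gamma x * y ^ y := by
  have hy := hx.trans_le hxy
  have hGx := Real.Gamma_pos_of_pos hx
  have hGy := Real.Gamma_pos_of_pos hy
  have h := antitoneOn_log_Gamma_add_sub hx hy hxy
  rw [← Real.log_le_log_iff (by positivity) (by positivity), Real.log_mul (by positivity)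
    (by positivity), Real.log_mul (by positivity) (by positivity), Real.log_exp,
    Real.log_mul (by positivity) (by positivity), Real.log_rpow hx, Real.log_rpow hy]
  dsimp only at h
  linarith

lemma marginal_constant_le {k l : ℕ} (hl : 3 ≤ l) {n : ℕ} (hn : n = k + l) :
    √Real.pi ^ l / Real.Gamma (l / 2 + 1) * (l / 2) *
        (l - 2) ^ ((l : ℝ) / 2 - 1) * Real.exp (n / 2 - (l / 2 - 1)) * n * √(2 * Real.pi) ^ k ≤
      n / (l - 2) * (√Real.pi ^ n / Real.Gamma (n / 2 + 1) * n ^ ((n : ℝ) / 2) * (n / 2)) := by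
  obtain ⟨m, hm⟩ : ∃ m : ℝ, m = l / 2 - 1 := ⟨_, rfl⟩
  obtain ⟨M, hM⟩ : ∃ M : ℝ, M = n / 2 := ⟨_, rfl⟩
  have hl' : (3 : ℝ) ≤ l := by exact_mod_cast hl
  have hn' : (n : ℝ) = k + l := by exact_mod_cast hn
  have hm0 : 0 < m := by linarith
  have hmM : m ≤ M := by have : (0 : ℝ) ≤ k := k.cast_nonneg
                         linarith
  have hM0 : 0 < M := hm0.trans_le hmM
  have hGm := Real.Gamma_pos_of_pos hm0
  have hGM := Real.Gamma_pos_of_pos hM0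
  have key := Gamma_mul_rpow_le hm0 hmM
  have h2 : √2 ^ k * 2 ^ m * 2 = (2 : ℝ) ^ M := by
    rw [Real.sqrt_eq_rpow, ← Real.rpow_mul_natCast zero_le_two, ← Real.rpow_add zero_lt_two,
      ← Real.rpow_add_one two_ne_zero]
    congr 1
    linarith
  rw [show (l : ℝ) / 2 = m + 1 by linarith, show (n : ℝ) / 2 = M by linarith,
    show (l : ℝ) - 2 = 2 * m by linarith, show (n : ℝ) = 2 * M by linarith,
    Real.Gamma_add_one (by positivity), Real.Gamma_add_one hm0.ne', Real.Gamma_add_one hM0.ne',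
    add_sub_cancel_right, Real.mul_rpow zero_le_two hm0.le, Real.mul_rpow zero_le_two hM0.le,
    Real.sqrt_mul zero_le_two, mul_pow, hn, pow_add, ← h2]
  have e1 : √Real.pi ^ l / ((m + 1) * (m * Real.Gamma m)) * (m + 1) * (2 ^ m * m ^ m) *
      Real.exp (M - m) * (2 * M) * (√2 ^ k * √Real.pi ^ k) =
      (√Real.pi ^ l * √Real.pi ^ k * √2 ^ k * 2 ^ m * 2 * M / (m * Real.Gamma m * Real.Gamma M)) *
        (Real.Gamma M * m ^ m * Real.exp (M - m)) := by
    field_simp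
  have e2 : 2 * M / (2 * m) * (√Real.pi ^ k * √Real.pi ^ l / (M * Real.Gamma M) *
      (√2 ^ k * 2 ^ m * 2 * M ^ M) * M) =
      (√Real.pi ^ l * √Real.pi ^ k * √2 ^ k * 2 ^ m * 2 * M / (m * Real.Gamma m * Real.Gamma M)) *
        (Real.Gamma m * M ^ M) := by
    field_simp
  rw [e1, e2]
  gcongr

lemma map_restrict_sphericalShell (n : ℕ) (N u : ℝ)
    (T : EuclideanSpace ℝ (Fin n) ≃ₗᵢ[ℝ] EuclideanSpace ℝ (Fin n)) :
    (volume.restrict (sphericalShell n N u)).map T = volume.restrict (sphericalShell n N u) := by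
  have h := (T.measurePreserving.restrict_preimage (measurableSet_sphericalShell n N u)).map_eq
  have hpre : T ⁻¹' sphericalShell n N u = sphericalShell n N u := by
    ext y
    simp [sphericalShell]
  rwa [hpre] at h

lemma map_cond_sphericalShell_eq {n : ℕ} {N u : ℝ} (hN : 0 < N)
    (hS : volume (sphericalShell n N u) ≠ 0)
    {μ : Measure (EuclideanSpace ℝ (Fin n))} [IsProbabilityMeasure μ]
    (hsupp : ∀ᵐ x ∂μ, ‖x‖ = √N)
    (hinv : ∀ T : EuclideanSpace ℝ (Fin n) ≃ₗᵢ[ℝ] EuclideanSpace ℝ (Fin n), μ.map T = μ) :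
    (volume[|sphericalShell n N u]).map (fun y ↦ (√N / ‖y‖) • y) = μ := by
  have : IsProbabilityMeasure (volume[|sphericalShell n N u]) :=
    cond_isProbabilityMeasure_of_finite hS (volume_sphericalShell_lt_top n N u).ne
  have hg : Measurable fun y : EuclideanSpace ℝ (Fin n) ↦ (√N / ‖y‖) • y := by fun_prop
  have : IsProbabilityMeasure ((volume[|sphericalShell n N u]).map fun y ↦ (√N / ‖y‖) • y) :=
    Measure.isProbabilityMeasure_map hg.aemeasurable
  refine eq_of_rotation_invariant_of_sphere (fun T ↦ ?_) hinv (Real.sqrt_pos.2 hN) ?_ hsupp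
  · have hT : Measurable T := T.continuous.measurable
    rw [Measure.map_map hT hg]
    conv_rhs => rw [ProbabilityTheory.cond, ← map_restrict_sphericalShell n N u T,
      ← Measure.map_smul, Measure.map_map hg hT]
    simp [Function.comp_def, ProbabilityTheory.cond]
  · rw [ae_map_iff hg.aemeasurable (measurableSet_eq_fun (by fun_prop) (by fun_prop))]
    filter_upwards [ae_cond_mem (measurableSet_sphericalShell n N u)] with y hy
    have hy0 : 0 < ‖y‖ := by
      refine (norm_nonneg y).lt_of_ne fun h ↦ ?_
      have := hy.1
      rw [← h] at this
      linarith
    rw [norm_smul, Real.norm_of_nonneg (by positivity), div_mul_cancel₀ _ hy0.ne']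

lemma norm_sub_radial_projection_le {n : ℕ} {N u : ℝ} (hN : 0 < N) (hu : 0 < u)
    {y : EuclideanSpace ℝ (Fin n)} (hy : y ∈ sphericalShell n N u) :
    ‖y - (√N / ‖y‖) • y‖ ≤ √N * u := by
  have h1 : √N ≤ ‖y‖ := Real.sqrt_le_iff.2 ⟨norm_nonneg _, hy.1⟩
  have hs := Real.sqrt_pos.2 hN
  have hy0 : 0 < ‖y‖ := hs.trans_le h1
  have h2 : ‖y‖ ≤ √N * (1 + u) := by
    refine le_of_sq_le_sq ?_ (by positivity)
    rw [mul_pow, Real.sq_sqrt hN.le]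
    nlinarith [hy.2, mul_pos hN hu, mul_pos hN (mul_pos hu hu)]
  have h3 : y - (√N / ‖y‖) • y = (1 - √N / ‖y‖) • y := by rw [sub_smul, one_smul]
  rw [h3, norm_smul, Real.norm_of_nonneg (sub_nonneg.2 ((div_le_one hy0).2 h1)), sub_mul,
    div_mul_cancel₀ _ hy0.ne']
  linarith

lemma volume_sphericalShell_mul_le {k l : ℕ} {N u : ℝ} (hN : 0 < N) (hu : 0 < u)
    (hS : volume (sphericalShell (k + l) N u) ≠ 0)
    {μ : Measure (EuclideanSpace ℝ (Fin (k + l)))} [IsProbabilityMeasure μ]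
    (hsupp : ∀ᵐ x ∂μ, ‖x‖ = √N)
    (hinv : ∀ T : EuclideanSpace ℝ (Fin (k + l)) ≃ₗᵢ[ℝ] EuclideanSpace ℝ (Fin (k + l)),
      μ.map T = μ) {F : Set (Fin k → ℝ)} (hF : MeasurableSet F) :
    volume (sphericalShell (k + l) N u) * μ.map (fun x i ↦ x (Fin.castAdd l i)) F ≤
      volume (sphericalShell (k + l) N u ∩
        (fun x i ↦ x (Fin.castAdd l i)) ⁻¹' Metric.cthickening (√N * u) F) := by
  set f : EuclideanSpace ℝ (Fin (k + l)) → Fin k → ℝ := fun x i ↦ x (Fin.castAdd l i)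
  have hf : Measurable f := by fun_prop
  have hg : Measurable fun y : EuclideanSpace ℝ (Fin (k + l)) ↦ (√N / ‖y‖) • y := by fun_prop
  conv_lhs => rw [← map_cond_sphericalShell_eq hN hS hsupp hinv]
  rw [Measure.map_map hf hg, Measure.map_apply (hf.comp hg) hF,
    cond_apply (measurableSet_sphericalShell _ _ _), ← mul_assoc,
    ENNReal.mul_inv_cancel hS (volume_sphericalShell_lt_top _ _ _).ne, one_mul]
  refine measure_mono fun y hy ↦ ⟨hy.1, ?_⟩
  refine Metric.mem_cthickening_of_dist_le _ _ _ _ hy.2 ?_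
  rw [dist_pi_le_iff (by positivity)]
  intro i
  refine le_trans ?_ (norm_sub_radial_projection_le hN hu hy.1)
  exact PiLp.norm_apply_le (y - (√N / ‖y‖) • y) (Fin.castAdd l i)

open Filter Topology in
lemma map_castAdd_closed_le {k l : ℕ} (hl : 3 ≤ l)
    {μ : Measure (EuclideanSpace ℝ (Fin (k + l)))} [IsProbabilityMeasure μ]
    (hsupp : ∀ᵐ x ∂μ, ‖x‖ = √(k + l : ℕ))
    (hinv : ∀ T : EuclideanSpace ℝ (Fin (k + l)) ≃ₗᵢ[ℝ] EuclideanSpace ℝ (Fin (k + l)),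
      μ.map T = μ) {F : Set (Fin k → ℝ)} (hF : IsClosed F) :
    μ.map (fun x i ↦ x (Fin.castAdd l i)) F ≤
      ENNReal.ofReal ((k + l : ℕ) / (l - 2)) *
        Measure.pi (fun _ : Fin k => gaussianReal 0 1) F := by
  set N : ℝ := ((k + l : ℕ) : ℝ) with hNdef
  set Q := Measure.pi (fun _ : Fin k => gaussianReal 0 1)
  have hl' : (3 : ℝ) ≤ l := by exact_mod_cast hl
  have hl2 : (0 : ℝ) < l - 2 := by linarith
  have hN : 0 < N := by rw [hNdef]; exact_mod_cast (by omega)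
  have hG : 0 < Real.Gamma (N / 2 + 1) := Real.Gamma_pos_of_pos (by positivity)
  obtain ⟨c, hc⟩ : ∃ c : ℝ, c =
    √Real.pi ^ (k + l) / Real.Gamma (N / 2 + 1) * N ^ (N / 2) * (N / 2) := ⟨_, rfl⟩
  have hc0 : 0 < c := by rw [hc]; positivity
  have hbound (u : ℝ) (hu : 0 < u) : μ.map (fun x i ↦ x (Fin.castAdd l i)) F ≤
      ENNReal.ofReal (N / (l - 2) * Real.exp (N * u / 2)) *
        Q (Metric.cthickening (√N * u) F) := by
    have h1 : ENNReal.ofReal (c * u) ≤ volume (sphericalShell (k + l) N u) := by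
      rw [hc]
      exact le_volume_sphericalShell (by omega) hN hu
    have hcu : 0 < ENNReal.ofReal (c * u) := by
      rw [ENNReal.ofReal_pos]; positivity
    have h2 := volume_sphericalShell_mul_le hN hu (hcu.trans_le h1).ne' hsupp hinv
      hF.measurableSet
    have h3 := volume_sphericalShell_inter_le (k := k) hl hN hu
      (Metric.isClosed_cthickening (δ := √N * u) (E := F)).measurableSet
    have h4 := (mul_le_mul_left h1 _).trans (h2.trans h3)
    rw [← ENNReal.mul_le_mul_iff_right hcu.ne' ENNReal.ofReal_ne_top, ← mul_assoc,
      ← ENNReal.ofReal_mul (by positivity)]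
    refine h4.trans (mul_le_mul_left (ENNReal.ofReal_le_ofReal ?_) _)
    have h5 := marginal_constant_le (k := k) hl rfl
    rw [← hNdef, ← hc] at h5
    have h6 := mul_le_mul_of_nonneg_right h5 (by positivity : 0 ≤ Real.exp (N * u / 2) * u)
    have h7 : Real.exp (N * (1 + u) / 2 - (l / 2 - 1)) =
        Real.exp (N / 2 - (l / 2 - 1)) * Real.exp (N * u / 2) := by
      rw [← Real.exp_add]; ring_nf
    rw [h7]
    linarith
  have hlim : Tendsto (fun u : ℝ ↦ ENNReal.ofReal (N / (l - 2) * Real.exp (N * u / 2)) *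
      Q (Metric.cthickening (√N * u) F)) (𝓝[>] 0) (𝓝 (ENNReal.ofReal (N / (l - 2)) * Q F)) := by
    refine ENNReal.Tendsto.mul ?_ (Or.inr (measure_ne_top _ _)) ?_ (Or.inr ENNReal.ofReal_ne_top)
    · refine ENNReal.tendsto_ofReal (tendsto_nhdsWithin_of_tendsto_nhds ?_)
      have : Continuous fun u : ℝ ↦ N / (l - 2) * Real.exp (N * u / 2) := by fun_prop
      simpa using this.tendsto 0
    · refine (tendsto_measure_cthickening_of_isClosed ⟨1, one_pos, measure_ne_top _ _⟩ hF).comp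
        (tendsto_nhdsWithin_of_tendsto_nhds ?_)
      have : Continuous fun u : ℝ ↦ √N * u := by fun_prop
      simpa using this.tendsto 0
  refine ge_of_tendsto hlim ?_
  filter_upwards [self_mem_nhdsWithin] with u hu using hbound u hu

lemma measure_le_of_forall_isClosed {α : Type*} [TopologicalSpace α] [MeasurableSpace α]
    {μ ν : Measure α} [IsFiniteMeasure μ] [μ.WeaklyRegular] {c : ENNReal}
    (h : ∀ F, IsClosed F → μ F ≤ c * ν F) {A : Set α} (hA : MeasurableSet A) : μ A ≤ c * ν A := by
  refine ENNReal.le_of_forall_pos_le_add fun ε hε _ ↦ ?_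
  obtain ⟨F, hFA, hF, hlt⟩ := hA.exists_isClosed_lt_add (measure_ne_top μ A)
    (ENNReal.coe_ne_zero.2 hε.ne')
  refine hlt.le.trans ?_
  gcongr
  exact (h F hF).trans (by gcongr)

lemma dTV_le_of_le_mul {α : Type*} [MeasurableSpace α] {μ ν : Measure α} [IsProbabilityMeasure μ]
    [IsProbabilityMeasure ν] {c : ℝ} (hc : 1 ≤ c)
    (h : ∀ A, MeasurableSet A → μ A ≤ ENNReal.ofReal c * ν A) : dTV μ ν ≤ 2 * (c - 1) := by
  have h1 (A : Set α) (hA : MeasurableSet A) : μ.real A - ν.real A ≤ c - 1 := by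
    have h2 := ENNReal.toReal_mono (by finiteness) (h A hA)
    rw [ENNReal.toReal_mul, ENNReal.toReal_ofReal (by linarith)] at h2
    change μ.real A ≤ c * ν.real A at h2
    nlinarith [measureReal_le_one (μ := ν) (s := A)]
  refine mul_le_mul_of_nonneg_left ?_ zero_le_two
  have : Nonempty {s : Set α // MeasurableSet s} := ⟨⟨∅, .empty⟩⟩
  refine ciSup_le fun ⟨A, hA⟩ ↦ abs_sub_le_iff.2 ⟨h1 A hA, ?_⟩
  have h2 := h1 Aᶜ hA.compl
  rw [probReal_compl_eq_one_sub hA, probReal_compl_eq_one_sub hA] at h2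
  change ν.real A - μ.real A ≤ c - 1
  linarith

/-- Diaconis–Freedman: if `X` is a uniform random point on the sphere of radius `√n` in `ℝⁿ`
(characterized as a rotation-invariant probability measure concentrated on that sphere),
`n ≥ 5`, `1 ≤ k ≤ n−4`, and `Z` is a standard Gaussian vector in `ℝ^k`, then
`d_TV((X₁,…,X_k), Z) ≤ 2(k+3)/(n−k−3)`. -/
theorem stmt_14 (n k : ℕ) (hn : 5 ≤ n) (hk : 1 ≤ k) (hkn : k ≤ n - 4)
    (μ : Measure (EuclideanSpace ℝ (Fin n))) [IsProbabilityMeasure μ]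
    (hsupp : μ (Metric.sphere (0 : EuclideanSpace ℝ (Fin n)) (Real.sqrt n)) = 1)
    (hinv : ∀ T : EuclideanSpace ℝ (Fin n) ≃ₗᵢ[ℝ] EuclideanSpace ℝ (Fin n),
      μ.map T = μ) :
    dTV (μ.map fun x (i : Fin k) => x (Fin.castLE (le_trans hkn (Nat.sub_le n 4)) i))
        (Measure.pi fun _ : Fin k => gaussianReal 0 1)
      ≤ 2 * ((k : ℝ) + 3) / ((n : ℝ) - (k : ℝ) - 3) := by
  obtain ⟨l, rfl⟩ : ∃ l, n = k + l := ⟨n - k, by omega⟩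
  have hl : 4 ≤ l := by omega
  have hl' : (4 : ℝ) ≤ l := by exact_mod_cast hl
  have hl2 : (0 : ℝ) < l - 2 := by linarith
  have hk0 : (0 : ℝ) ≤ k := k.cast_nonneg
  have hf : Measurable fun (x : EuclideanSpace ℝ (Fin (k + l))) (i : Fin k) ↦
    x (Fin.castAdd l i) := by fun_prop
  have hsupp' : ∀ᵐ x ∂μ, ‖x‖ = √(k + l : ℕ) := by
    have := (prob_compl_eq_zero_iff Metric.isClosed_sphere.measurableSet).2 hsupp
    filter_upwards [compl_mem_ae_iff.2 this] with x hx
    simpa using hx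
  change dTV (μ.map fun x i ↦ x (Fin.castAdd l i)) _ ≤ _
  have := Measure.isProbabilityMeasure_map (μ := μ) hf.aemeasurable
  refine (dTV_le_of_le_mul (c := (k + l : ℕ) / (l - 2)) ?_ fun A hA ↦
    measure_le_of_forall_isClosed
      (fun F hF ↦ map_castAdd_closed_le (by omega) hsupp' hinv hF) hA).trans ?_
  · rw [one_le_div hl2]
    push_cast
    linarith
  · push_cast
    rw [mul_div_assoc]
    gcongr
    rw [div_sub_one hl2.ne']
    exact div_le_div₀ (by linarith) (by linarith) (by linarith) (by linarith)
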